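/- arXiv:math-ph/0502030 — 2 statements merged into one kernel-verified Lean document; each statement's English description precedes it below -/
import Mathlib

section
/- Let B > 0 and s ≠ 0 be real. The infinite matrix X(s) indexed by m,n ∈ ℕ∪{0} with entries X(s)_{mm} = 0 and, for m ≠ n, X(s)_{mn} = −(sgn(s)/(4B(n−m)²))·min{γ_m(s)/γ_n(s), γ_n(s)/γ_m(s)} defines a bounded linear operator on ℓ²(ℕ∪{0}) whose operator norm satisfies ‖X(s)‖ ≤ π²/(12B). -/
/-- `γ_n(s) = (Γ(n+|s|+1)/n!)^{1/2}`. -/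
noncomputable def gammaCoef (s : ℝ) (n : ℕ) : ℝ :=
  Real.sqrt (Real.Gamma ((n : ℝ) + |s| + 1) / (Nat.factorial n : ℝ))

/-- The matrix `X(s)`, indexed by `m, n ∈ ℕ ∪ {0}`. -/
noncomputable def Xmat (B s : ℝ) (m n : ℕ) : ℂ :=
  if m = n then 0
  else ((-(Real.sign s / (4 * B * ((n : ℝ) - (m : ℝ)) ^ 2)) *
    min (gammaCoef s m / gammaCoef s n) (gammaCoef s n / gammaCoef s m) : ℝ) : ℂ)

/-- The quadratic estimate behind the Schur test, for a nonnegative kernel `k` and a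
square-summable nonnegative sequence `a`. -/
theorem schur_sq_bound (k : ℕ → ℕ → ℝ) (C : ℝ) (hk : ∀ m n, 0 ≤ k m n)
    (hrow : ∀ m, Summable (k m)) (hrowC : ∀ m, ∑' n, k m n ≤ C)
    (hcol : ∀ n, Summable fun m => k m n) (hcolC : ∀ n, ∑' m, k m n ≤ C)
    (a : ℕ → ℝ) (ha : ∀ n, 0 ≤ a n) (ha2 : Summable fun n => a n ^ 2) :
    (∀ m, Summable fun n => k m n * a n) ∧
      (Summable fun m => (∑' n, k m n * a n) ^ 2) ∧
      ∑' m, (∑' n, k m n * a n) ^ 2 ≤ C ^ 2 * ∑' n, a n ^ 2 := by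
  have hC : 0 ≤ C := (tsum_nonneg (hk 0)).trans (hrowC 0)
  have hcolle : ∀ n, ∑' m, k m n * a n ^ 2 ≤ C * a n ^ 2 := fun n => by
    rw [tsum_mul_right]
    exact mul_le_mul_of_nonneg_right (hcolC n) (sq_nonneg _)
  have hdouble : Summable (fun p : ℕ × ℕ => k p.2 p.1 * a p.1 ^ 2) := by
    have hnonneg : 0 ≤ fun p : ℕ × ℕ => k p.2 p.1 * a p.1 ^ 2 := fun p =>
      mul_nonneg (hk p.2 p.1) (sq_nonneg _)
    rw [summable_prod_of_nonneg hnonneg]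
    exact ⟨fun n => (hcol n).mul_right (a n ^ 2), Summable.of_nonneg_of_le
      (fun n => tsum_nonneg fun m => hnonneg (n, m)) hcolle (ha2.mul_left C)⟩
  have hdoubleC : ∑' m, ∑' n, k m n * a n ^ 2 ≤ C * ∑' n, a n ^ 2 := by
    rw [Summable.tsum_comm (f := fun n m => k m n * a n ^ 2) hdouble, ← tsum_mul_left]
    exact Summable.tsum_le_tsum hcolle hdouble.prod (ha2.mul_left C)
  have hcs : ∀ m, Summable (fun n => k m n * a n) ∧
      (∑' n, k m n * a n) ^ 2 ≤ C * ∑' n, k m n * a n ^ 2 := by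
    intro m
    have h1 : ∀ n, √(k m n) ^ (2 : ℝ) = k m n := fun n => by
      rw [Real.rpow_two, Real.sq_sqrt (hk m n)]
    have h2 : ∀ n, (√(k m n) * a n) ^ (2 : ℝ) = k m n * a n ^ 2 := fun n => by
      rw [Real.rpow_two, mul_pow, Real.sq_sqrt (hk m n)]
    have h3 : ∀ n, √(k m n) * (√(k m n) * a n) = k m n * a n := fun n => by
      rw [← mul_assoc, Real.mul_self_sqrt (hk m n)]
    have h4 : Summable fun n => k m n * a n ^ 2 := hdouble.prod_symm.prod_factor m
    have hpos : 0 ≤ ∑' n, k m n * a n ^ 2 :=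
      tsum_nonneg fun n => mul_nonneg (hk m n) (sq_nonneg _)
    obtain ⟨hs, hle⟩ := Real.summable_and_inner_le_Lp_mul_Lq_tsum_of_nonneg Real.HolderConjugate.two_two
      (f := fun n => √(k m n)) (g := fun n => √(k m n) * a n)
      (fun n => Real.sqrt_nonneg _) (fun n => mul_nonneg (Real.sqrt_nonneg _) (ha n))
      (by simpa only [h1] using hrow m) (by simpa only [h2] using h4)
    simp only [h1, h2, h3, ← Real.sqrt_eq_rpow] at hs hle
    refine ⟨hs, ?_⟩
    calc (∑' n, k m n * a n) ^ 2
        ≤ (√(∑' n, k m n) * √(∑' n, k m n * a n ^ 2)) ^ 2 :=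
          pow_le_pow_left₀ (tsum_nonneg fun n => mul_nonneg (hk m n) (ha n)) hle 2
      _ = (∑' n, k m n) * ∑' n, k m n * a n ^ 2 := by
          rw [mul_pow, Real.sq_sqrt (tsum_nonneg (hk m)), Real.sq_sqrt hpos]
      _ ≤ _ := mul_le_mul_of_nonneg_right (hrowC m) hpos
  have hmajor : Summable fun m => C * ∑' n, k m n * a n ^ 2 := hdouble.prod_symm.prod.mul_left C
  have hsq : Summable fun m => (∑' n, k m n * a n) ^ 2 :=
    Summable.of_nonneg_of_le (fun m => sq_nonneg _) (fun m => (hcs m).2) hmajor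
  refine ⟨fun m => (hcs m).1, hsq, ?_⟩
  calc ∑' m, (∑' n, k m n * a n) ^ 2
      ≤ ∑' m, C * ∑' n, k m n * a n ^ 2 := hsq.tsum_le_tsum (fun m => (hcs m).2) hmajor
    _ ≤ C * (C * ∑' n, a n ^ 2) := by
        rw [tsum_mul_left]
        exact mul_le_mul_of_nonneg_left hdoubleC hC
    _ = C ^ 2 * ∑' n, a n ^ 2 := by ring

/-- **Schur test**: an infinite matrix dominated entrywise by a nonnegative kernel whose row and
column sums are at most `C` acts on `ℓ²` with operator norm at most `C`. -/
theorem exists_clm_of_row_col_sum_le (A : ℕ → ℕ → ℂ) (k : ℕ → ℕ → ℝ) (C : ℝ)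
    (hA : ∀ m n, ‖A m n‖ ≤ k m n)
    (hrow : ∀ m, Summable (k m)) (hrowC : ∀ m, ∑' n, k m n ≤ C)
    (hcol : ∀ n, Summable fun m => k m n) (hcolC : ∀ n, ∑' m, k m n ≤ C) :
    ∃ T : lp (fun _ : ℕ => ℂ) 2 →L[ℂ] lp (fun _ : ℕ => ℂ) 2,
      ‖T‖ ≤ C ∧ ∀ x m, T x m = ∑' n, A m n * x n := by
  have hk : ∀ m n, 0 ≤ k m n := fun m n => (norm_nonneg _).trans (hA m n)
  have hC : 0 ≤ C := (tsum_nonneg (hk 0)).trans (hrowC 0)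
  have hx2 : ∀ x : lp (fun _ : ℕ => ℂ) 2, HasSum (fun n => ‖x n‖ ^ 2) (‖x‖ ^ 2) := by
    intro x
    simpa using lp.hasSum_norm (p := 2) (by simp) x
  have hschur := fun x : lp (fun _ : ℕ => ℂ) 2 =>
    schur_sq_bound k C hk hrow hrowC hcol hcolC (fun n => ‖x n‖) (fun n => norm_nonneg _)
      (hx2 x).summable
  have hterm : ∀ (x : lp (fun _ : ℕ => ℂ) 2) m n, ‖A m n * x n‖ ≤ k m n * ‖x n‖ :=
    fun x m n => by
      rw [norm_mul]
      exact mul_le_mul_of_nonneg_right (hA m n) (norm_nonneg _)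
  have hsum : ∀ (x : lp (fun _ : ℕ => ℂ) 2) m, Summable fun n => A m n * x n :=
    fun x m => Summable.of_norm_bounded ((hschur x).1 m) (hterm x m)
  have hbound : ∀ (x : lp (fun _ : ℕ => ℂ) 2) m,
      ‖∑' n, A m n * x n‖ ^ 2 ≤ (∑' n, k m n * ‖x n‖) ^ 2 := fun x m =>
    pow_le_pow_left₀ (norm_nonneg _) (tsum_of_norm_bounded ((hschur x).1 m).hasSum (hterm x m)) 2
  have hsq : ∀ x : lp (fun _ : ℕ => ℂ) 2, Summable fun m => ‖∑' n, A m n * x n‖ ^ 2 := fun x =>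
    Summable.of_nonneg_of_le (fun m => sq_nonneg _) (hbound x) (hschur x).2.1
  let L : lp (fun _ : ℕ => ℂ) 2 →ₗ[ℂ] lp (fun _ : ℕ => ℂ) 2 :=
    { toFun := fun x => ⟨fun m => ∑' n, A m n * x n,
        memℓp_gen (by simpa using hsq x)⟩
      map_add' := fun x y => by
        ext m
        simp only [lp.coeFn_add, Pi.add_apply, mul_add]
        exact (hsum x m).tsum_add (hsum y m)
      map_smul' := fun c x => by
        ext m
        simp only [lp.coeFn_smul, Pi.smul_apply, smul_eq_mul, RingHom.id_apply, ← tsum_mul_left]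
        exact tsum_congr fun n => by ring }
  refine ⟨L.mkContinuous C fun x => ?_, L.mkContinuous_norm_le hC _, fun x m => rfl⟩
  refine le_of_sq_le_sq ?_ (mul_nonneg hC (norm_nonneg x))
  calc ‖L x‖ ^ 2 = ∑' m, ‖∑' n, A m n * x n‖ ^ 2 := (hx2 (L x)).tsum_eq.symm
    _ ≤ ∑' m, (∑' n, k m n * ‖x n‖) ^ 2 := (hsq x).tsum_le_tsum (hbound x) (hschur x).2.1
    _ ≤ C ^ 2 * ∑' n, ‖x n‖ ^ 2 := (hschur x).2.2
    _ = (C * ‖x‖) ^ 2 := by rw [(hx2 x).tsum_eq, mul_pow]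

theorem hasSum_int_one_div_sq :
    HasSum (fun d : ℤ => 1 / (d : ℝ) ^ 2) (Real.pi ^ 2 / 3) := by
  have h : HasSum (fun d : ℤ => 1 / (d : ℝ) ^ 2) _ :=
    HasSum.of_nat_of_neg (by simpa using hasSum_zeta_two) (by simpa using hasSum_zeta_two)
  convert h using 1
  simp
  ring

theorem summable_one_div_sub_sq (m : ℕ) :
    Summable fun n : ℕ => 1 / ((n : ℝ) - m) ^ 2 := by
  have hinj : Function.Injective fun n : ℕ => (n : ℤ) - m := fun a b h => by simpa using h
  simpa [Function.comp_def] using hasSum_int_one_div_sq.summable.comp_injective hinj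

theorem tsum_one_div_sub_sq_le (m : ℕ) :
    ∑' n : ℕ, 1 / ((n : ℝ) - m) ^ 2 ≤ Real.pi ^ 2 / 3 := by
  have hinj : Function.Injective fun n : ℕ => (n : ℤ) - m := fun a b h => by simpa using h
  have h := tsum_comp_le_tsum_of_inj hasSum_int_one_div_sq.summable
    (fun d => by positivity) hinj
  rw [hasSum_int_one_div_sq.tsum_eq] at h
  simpa [Function.comp_def] using h

theorem min_div_div_le_one {a b : ℝ} (ha : 0 ≤ a) (hb : 0 ≤ b) : min (a / b) (b / a) ≤ 1 := by
  rcases le_total a b with h | h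
  · exact (min_le_left _ _).trans (div_le_one_of_le₀ h hb)
  · exact (min_le_right _ _).trans (div_le_one_of_le₀ h ha)

theorem norm_Xmat_le {B : ℝ} (s : ℝ) (hB : 0 < B) (m n : ℕ) :
    ‖Xmat B s m n‖ ≤ 1 / (4 * B) * (1 / ((n : ℝ) - m) ^ 2) := by
  unfold Xmat
  split_ifs with h
  · rw [norm_zero]
    positivity
  have hm : 0 ≤ gammaCoef s m := Real.sqrt_nonneg _
  have hn : 0 ≤ gammaCoef s n := Real.sqrt_nonneg _
  have hmin : 0 ≤ min (gammaCoef s m / gammaCoef s n) (gammaCoef s n / gammaCoef s m) :=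
    le_min (div_nonneg hm hn) (div_nonneg hn hm)
  have hsign : |Real.sign s| ≤ 1 := by
    rcases Real.sign_apply_eq s with h | h | h <;> simp [h]
  have hden : 0 ≤ 4 * B * ((n : ℝ) - m) ^ 2 := by positivity
  rw [Complex.norm_real, Real.norm_eq_abs, abs_mul, abs_neg, abs_div, abs_of_nonneg hden,
    abs_of_nonneg hmin]
  calc _ ≤ 1 / (4 * B * ((n : ℝ) - m) ^ 2) * 1 :=
        mul_le_mul (div_le_div_of_nonneg_right hsign hden) (min_div_div_le_one hm hn) hmin
          (by positivity)
    _ = _ := by rw [mul_one, one_div_mul_one_div]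

/-- For real `B > 0` and `s ≠ 0`, the matrix `X(s)` defines a bounded
linear operator on `ℓ²(ℕ∪{0})` with `‖X(s)‖ ≤ π²/(12B)`. -/
theorem stmt_14 (B s : ℝ) (hB : 0 < B) (hs : s ≠ 0) :
    ∃ T : lp (fun _ : ℕ => ℂ) 2 →L[ℂ] lp (fun _ : ℕ => ℂ) 2,
      ‖T‖ ≤ Real.pi ^ 2 / (12 * B) ∧
      ∀ m n : ℕ,
        @inner ℂ _ _ (lp.single 2 m (1 : ℂ)) (T (lp.single 2 n (1 : ℂ))) =
          Xmat B s m n := by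
  have hsum : ∀ m : ℕ, ∑' n : ℕ, 1 / (4 * B) * (1 / ((n : ℝ) - m) ^ 2) ≤
      Real.pi ^ 2 / (12 * B) := fun m => by
    rw [tsum_mul_left]
    calc _ ≤ 1 / (4 * B) * (Real.pi ^ 2 / 3) :=
          mul_le_mul_of_nonneg_left (tsum_one_div_sub_sq_le m) (by positivity)
      _ = _ := by field_simp; norm_num
  have hsymm : ∀ m n : ℕ, 1 / (4 * B) * (1 / ((n : ℝ) - m) ^ 2) =
      1 / (4 * B) * (1 / ((m : ℝ) - n) ^ 2) := fun m n => by rw [sub_sq_comm]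
  obtain ⟨T, hT, hTx⟩ := exists_clm_of_row_col_sum_le (Xmat B s)
    (fun m n => 1 / (4 * B) * (1 / ((n : ℝ) - m) ^ 2)) (Real.pi ^ 2 / (12 * B))
    (norm_Xmat_le s hB) (fun m => (summable_one_div_sub_sq m).mul_left _) hsum
    (fun n => by simpa only [hsymm _ n] using (summable_one_div_sub_sq n).mul_left (1 / (4 * B)))
    (fun n => by simpa only [hsymm _ n] using hsum n)
  refine ⟨T, hT, fun m n => ?_⟩
  rw [lp.inner_single_left, hTx, tsum_eq_single n fun j hj => by
    rw [lp.single_apply_ne _ _ _ hj, mul_zero], lp.single_apply_self]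
  simp
end

section
/- Let B > 0, s > 0 and let m, n ∈ ℕ∪{0} with m ≠ n. Then the function s ↦ X(s)_{mn} = −(1/(4B(n−m)²))·min{γ_m(s)/γ_n(s), γ_n(s)/γ_m(s)} is differentiable on (0,∞) and its derivative satisfies |d/ds X(s)_{mn}| ≤ (1/(8B))·(1/((m+1)(n+1)) + 1/(|n−m|·min{m+1, n+1})). -/
/-- The entry `X(s)_{mn}` (for `s > 0`) as a function of `s`. -/
noncomputable def Xentry (B : ℝ) (m n : ℕ) (s : ℝ) : ℝ :=
  -(1 / (4 * B * ((n : ℝ) - (m : ℝ)) ^ 2)) *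
    min (gammaCoef s m / gammaCoef s n) (gammaCoef s n / gammaCoef s m)

open Filter Topology

theorem gammaCoef_pos {s : ℝ} (hs : 0 < s) (n : ℕ) : 0 < gammaCoef s n := by
  unfold gammaCoef
  have : 0 < Real.Gamma ((n : ℝ) + |s| + 1) := Real.Gamma_pos_of_pos (by positivity)
  positivity

theorem gammaCoef_div_succ {s : ℝ} (hs : 0 < s) (n : ℕ) :
    gammaCoef s n / gammaCoef s (n + 1) = √(((n : ℝ) + 1) / ((n : ℝ) + 1 + s)) := by
  unfold gammaCoef
  have hG : 0 < Real.Gamma ((n : ℝ) + s + 1) := Real.Gamma_pos_of_pos (by positivity)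
  rw [abs_of_pos hs, ← Real.sqrt_div (by positivity), Nat.factorial_succ]
  push_cast
  rw [show (n : ℝ) + 1 + s + 1 = ((n : ℝ) + s + 1) + 1 by ring,
    Real.Gamma_add_one (s := (n : ℝ) + s + 1) (by positivity)]
  congr 1
  field_simp
  ring

theorem exists_hasDerivAt_sqrt_div_add {a s : ℝ} (ha : 0 < a) (hs : 0 < s) :
    ∃ D, HasDerivAt (fun t => √(a / (a + t))) D s ∧ |D| ≤ 1 / (2 * a) := by
  have has : 0 < a + s := by positivity
  have hq : 0 < √(a / (a + s)) := by positivity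
  have hq1 : √(a / (a + s)) ≤ 1 := by
    rw [Real.sqrt_le_one, div_le_one has]
    linarith
  have hd : HasDerivAt (fun t => a / (a + t)) ((0 * (a + s) - a * 1) / (a + s) ^ 2) s :=
    (hasDerivAt_const s a).div ((hasDerivAt_id s).const_add a) has.ne'
  refine ⟨_, hd.sqrt (by positivity), ?_⟩
  have hsq : √(a / (a + s)) ^ 2 = a / (a + s) := Real.sq_sqrt (by positivity)
  have : (0 * (a + s) - a * 1) / (a + s) ^ 2 / (2 * √(a / (a + s)))
      = -(√(a / (a + s)) / (2 * (a + s))) := by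
    rw [div_eq_iff (by positivity)]
    calc _ = -(a / (a + s) / (a + s)) := by field_simp; ring
      _ = -(√(a / (a + s)) ^ 2 / (a + s)) := by rw [hsq]
      _ = _ := by field_simp
  rw [this, abs_neg, abs_of_pos (by positivity)]
  gcongr
  linarith

theorem gammaCoef_div_le_one {s : ℝ} (hs : 0 < s) {m n : ℕ} (h : m ≤ n) :
    gammaCoef s m / gammaCoef s n ≤ 1 := by
  have hmono : Monotone (gammaCoef s) := by
    refine monotone_nat_of_le_succ fun k => ?_
    rw [← div_le_one (gammaCoef_pos hs _), gammaCoef_div_succ hs, Real.sqrt_le_one,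
      div_le_one (by positivity)]
    linarith
  exact (div_le_one (gammaCoef_pos hs n)).2 (hmono h)

theorem exists_hasDerivAt_gammaCoef_div {s : ℝ} (hs : 0 < s) {m n : ℕ} (h : m ≤ n) :
    ∃ D, HasDerivAt (fun t => gammaCoef t m / gammaCoef t n) D s ∧
      |D| ≤ ((n : ℝ) - m) / (2 * ((m : ℝ) + 1)) := by
  induction n, h using Nat.le_induction with
  | base =>
    refine ⟨0, (hasDerivAt_const s (1 : ℝ)).congr_of_eventuallyEq ?_, by simp⟩
    filter_upwards [eventually_gt_nhds hs] with t ht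
    exact div_self (gammaCoef_pos ht m).ne'
  | succ n hmn ih =>
    obtain ⟨D, hD, hDle⟩ := ih
    obtain ⟨E, hE, hEle⟩ :=
      exists_hasDerivAt_sqrt_div_add (a := (n : ℝ) + 1) (by positivity) hs
    refine ⟨_, (hD.mul hE).congr_of_eventuallyEq ?_, ?_⟩
    · filter_upwards [eventually_gt_nhds hs] with t ht
      rw [Pi.mul_apply, ← gammaCoef_div_succ ht, div_mul_div_cancel₀ (gammaCoef_pos ht n).ne']
    · have hQ := gammaCoef_div_le_one hs hmn
      have hQ0 := (div_pos (gammaCoef_pos hs m) (gammaCoef_pos hs n)).le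
      have hq := gammaCoef_div_le_one hs n.le_succ
      rw [Nat.succ_eq_add_one, gammaCoef_div_succ hs] at hq
      have hE' : 1 / (2 * ((n : ℝ) + 1)) ≤ 1 / (2 * ((m : ℝ) + 1)) := by gcongr
      calc _ ≤ |D| * √(((n : ℝ) + 1) / ((n : ℝ) + 1 + s))
            + gammaCoef s m / gammaCoef s n * |E| := by
            refine (abs_add_le _ _).trans_eq ?_
            rw [abs_mul, abs_mul, abs_of_nonneg hQ0, abs_of_nonneg (Real.sqrt_nonneg _)]
        _ ≤ |D| * 1 + 1 * |E| := by gcongr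
        _ ≤ ((n : ℝ) - m) / (2 * ((m : ℝ) + 1)) + 1 / (2 * ((m : ℝ) + 1)) := by linarith
        _ = _ := by push_cast; ring

theorem Xentry_comm (B : ℝ) (m n : ℕ) : Xentry B m n = Xentry B n m := by
  ext t
  unfold Xentry
  rw [min_comm, sub_sq_comm]

theorem exists_hasDerivAt_Xentry {B s : ℝ} (hB : 0 < B) (hs : 0 < s) {m n : ℕ} (hmn : m < n) :
    ∃ D, HasDerivAt (Xentry B m n) D s ∧
      |D| ≤ 1 / (8 * B) * (1 / (((n : ℝ) - m) * ((m : ℝ) + 1))) := by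
  obtain ⟨D, hD, hDle⟩ := exists_hasDerivAt_gammaCoef_div hs hmn.le
  have hd : 0 < (n : ℝ) - m := sub_pos.2 (by exact_mod_cast hmn)
  refine ⟨_, (hD.const_mul (-(1 / (4 * B * ((n : ℝ) - m) ^ 2)))).congr_of_eventuallyEq ?_, ?_⟩
  · filter_upwards [eventually_gt_nhds hs] with t ht
    have h1 := gammaCoef_div_le_one ht hmn.le
    have h2 : 1 ≤ gammaCoef t n / gammaCoef t m := by
      rw [← inv_div]
      exact (one_le_inv₀ (div_pos (gammaCoef_pos ht m) (gammaCoef_pos ht n))).2 h1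
    rw [Xentry, min_eq_left (h1.trans h2)]
  · rw [abs_mul, abs_neg, abs_of_pos (by positivity)]
    calc _ ≤ 1 / (4 * B * ((n : ℝ) - m) ^ 2) * (((n : ℝ) - m) / (2 * ((m : ℝ) + 1))) := by gcongr
      _ = _ := by field_simp; norm_num

/-- For `B > 0`, `s > 0` and `m ≠ n` in `ℕ∪{0}`, the function
`s ↦ X(s)_{mn}` is differentiable on `(0,∞)` and
`|d/ds X(s)_{mn}| ≤ (1/(8B))·(1/((m+1)(n+1)) + 1/(|n−m|·min{m+1,n+1}))`. -/
theorem stmt_15 (B s : ℝ) (hB : 0 < B) (hs : 0 < s) (m n : ℕ) (hmn : m ≠ n) :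
    DifferentiableAt ℝ (Xentry B m n) s ∧
    |deriv (Xentry B m n) s| ≤
      (1 / (8 * B)) *
        (1 / (((m : ℝ) + 1) * ((n : ℝ) + 1)) +
          1 / (|(n : ℝ) - (m : ℝ)| * min ((m : ℝ) + 1) ((n : ℝ) + 1))) := by
  wlog h : m < n generalizing m n
  · have := this n m hmn.symm (lt_of_le_of_ne (not_lt.1 h) hmn.symm)
    rwa [Xentry_comm, abs_sub_comm, min_comm, mul_comm ((n : ℝ) + 1)] at this
  obtain ⟨D, hD, hDle⟩ := exists_hasDerivAt_Xentry hB hs h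
  have hmn' : (m : ℝ) < n := by exact_mod_cast h
  refine ⟨hD.differentiableAt, ?_⟩
  rw [hD.deriv, abs_of_pos (sub_pos.2 hmn'), min_eq_left (by linarith)]
  refine hDle.trans ?_
  gcongr
  exact le_add_of_nonneg_left (by positivity)
end
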